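/- Let (Z,ρ₀) be an antipodal space and fix ρ₁ ∈ M(Z). Then the map C(Z) → M(Z), τ₀ ↦ P_∞(τ₀, ρ₁), is continuous (from C(Z) with the sup-norm topology to M(Z) with the metric d_M). -/

import Mathlib

open Filter Topology
open scoped Classical

variable {Z : Type*}

/-- `Z` has at least four points. -/
def HasFourPoints (Z : Type*) : Prop :=
  ∃ a b c d : Z, a ≠ b ∧ a ≠ c ∧ a ≠ d ∧ b ≠ c ∧ b ≠ d ∧ c ≠ d

/-- A separating function on `Z`: continuous, symmetric, and positive. -/
structure IsSeparating [TopologicalSpace Z] (ρ : Z → Z → ℝ) : Prop where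
  continuous : Continuous fun p : Z × Z => ρ p.1 p.2
  symm : ∀ ξ η, ρ ξ η = ρ η ξ
  nonneg : ∀ ξ η, 0 ≤ ρ ξ η
  eq_zero_iff : ∀ ξ η, ρ ξ η = 0 ↔ ξ = η

/-- The cross-ratio of a quadruple of points with respect to `ρ`. -/
noncomputable def crossRatio (ρ : Z → Z → ℝ) (ξ ξ' η η' : Z) : ℝ :=
  ρ ξ η * ρ ξ' η' / (ρ ξ η' * ρ ξ' η)

/-- Two functions are Moebius equivalent if their cross-ratios agree on all quadruples
of pairwise distinct points. -/
def MoebiusEquiv (ρ₁ ρ₂ : Z → Z → ℝ) : Prop :=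
  ∀ ξ ξ' η η' : Z, ξ ≠ ξ' → ξ ≠ η → ξ ≠ η' → ξ' ≠ η → ξ' ≠ η' → η ≠ η' →
    crossRatio ρ₁ ξ ξ' η η' = crossRatio ρ₂ ξ ξ' η η'

/-- An antipodal function on `Z`: a separating function with values in `[0,1]` such that
every point has an antipode. -/
structure IsAntipodal [TopologicalSpace Z] (ρ : Z → Z → ℝ) : Prop where
  toIsSeparating : IsSeparating ρ
  le_one : ∀ ξ η, ρ ξ η ≤ 1
  antipode : ∀ ξ, ∃ η, ρ ξ η = 1

/-- The Moebius space `M(Z, ρ₀)`: antipodal functions Moebius equivalent to `ρ₀`. -/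
def MoebiusSpace [TopologicalSpace Z] (ρ₀ : Z → Z → ℝ) : Set (Z → Z → ℝ) :=
  {ρ | IsAntipodal ρ ∧ MoebiusEquiv ρ₀ ρ}

/-- The derivative `dρ₂/dρ₁`: the (unique, when it exists) positive continuous function
satisfying the geometric mean value theorem
`ρ₂(ξ,η)² = f(ξ) f(η) ρ₁(ξ,η)²`. -/
noncomputable def mDeriv [TopologicalSpace Z] (ρ₁ ρ₂ : Z → Z → ℝ) : Z → ℝ :=
  if h : ∃ f : Z → ℝ, Continuous f ∧ (∀ ξ, 0 < f ξ) ∧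
      ∀ ξ η, ρ₂ ξ η ^ 2 = f ξ * f η * ρ₁ ξ η ^ 2
  then h.choose else fun _ => 1

/-- The metric `d_M(ρ₁, ρ₂) = ‖log (dρ₂/dρ₁)‖_∞` on the Moebius space. -/
noncomputable def dM [TopologicalSpace Z] (ρ₁ ρ₂ : Z → Z → ℝ) : ℝ :=
  ⨆ ξ : Z, |Real.log (mDeriv ρ₁ ρ₂ ξ)|

/-- The discrepancy function `D_{ρ₁}(τ)(ξ) = max_{η ≠ ξ} (τ(ξ) + τ(η) + log ρ₁(ξ,η)²)`. -/
noncomputable def discrepancy [TopologicalSpace Z] (ρ₁ : Z → Z → ℝ) (τ : C(Z, ℝ))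
    (ξ : Z) : ℝ :=
  ⨆ η : {η : Z // η ≠ ξ}, (τ ξ + τ η.1 + Real.log (ρ₁ ξ η.1 ^ 2))

/-- `E_{ρ₁}(τ)(ξ,η) = e^{τ(ξ)/2} e^{τ(η)/2} ρ₁(ξ,η)`. -/
noncomputable def eMap [TopologicalSpace Z] (ρ₁ : Z → Z → ℝ) (τ : C(Z, ℝ)) :
    Z → Z → ℝ :=
  fun ξ η => Real.exp (τ ξ / 2) * Real.exp (τ η / 2) * ρ₁ ξ η

/-- A solution of the `ρ₁`-antipodal flow `dτ_t/dt = -D_{ρ₁}(τ_t)` on `[0, ∞)`. -/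
def IsAntipodalFlowSol [TopologicalSpace Z] [CompactSpace Z]
    (ρ₁ : Z → Z → ℝ) (τ : ℝ → C(Z, ℝ)) : Prop :=
  ∀ t ∈ Set.Ici (0 : ℝ), ∃ τ' : C(Z, ℝ),
    (∀ ξ, τ' ξ = -discrepancy ρ₁ (τ t) ξ) ∧
    HasDerivWithinAt τ τ' (Set.Ici (0 : ℝ)) t

/-- The antipodalization map `P_∞(τ₀, ρ₁) = E_{ρ₁}(τ_∞)`, where `τ_∞` is the limit as
`t → ∞` of the solution of the `ρ₁`-antipodal flow starting at `τ₀`. -/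
noncomputable def antipodalization [TopologicalSpace Z] [CompactSpace Z]
    (ρ₁ : Z → Z → ℝ) (τ₀ : C(Z, ℝ)) : Z → Z → ℝ :=
  if h : ∃ p : (ℝ → C(Z, ℝ)) × C(Z, ℝ), p.1 0 = τ₀ ∧ IsAntipodalFlowSol ρ₁ p.1 ∧
      Filter.Tendsto p.1 Filter.atTop (𝓝 p.2)
  then eMap ρ₁ h.choose.2 else ρ₁

theorem norm_exp_smul_integral_le {E : Type*} [NormedAddCommGroup E] [NormedSpace ℝ E]
    {g : ℝ → E} {l C s : ℝ} (hl : 0 < l) (hC : 0 ≤ C) (hs : 0 ≤ s)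
    (hg : ∀ r, 0 ≤ r → ‖g r‖ ≤ C * Real.exp (l * r)) :
    ‖Real.exp (-(l * s)) • ∫ r in (0 : ℝ)..s, g r‖ ≤ C / l := by
  have hI : ∫ r in (0 : ℝ)..s, C * Real.exp (l * r) = C * ((Real.exp (l * s) - 1) / l) := by
    rw [intervalIntegral.integral_const_mul, intervalIntegral.integral_comp_mul_left _ hl.ne']
    rw [integral_exp, mul_zero, Real.exp_zero, smul_eq_mul, div_eq_inv_mul]
  have h : ‖∫ r in (0 : ℝ)..s, g r‖ ≤ C * ((Real.exp (l * s) - 1) / l) := by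
    rw [← hI]
    refine intervalIntegral.norm_integral_le_of_norm_le hs
      (Eventually.of_forall fun r hr => hg r hr.1.le) ?_
    exact (by fun_prop : Continuous fun r => C * Real.exp (l * r)).intervalIntegrable _ _
  rw [norm_smul, Real.norm_of_nonneg (Real.exp_pos _).le]
  calc Real.exp (-(l * s)) * ‖∫ r in (0 : ℝ)..s, g r‖
      ≤ Real.exp (-(l * s)) * (C * (Real.exp (l * s) / l)) := by
        refine mul_le_mul_of_nonneg_left (h.trans ?_) (Real.exp_pos _).le
        gcongr
        linarith
    _ = C / l * (Real.exp (-(l * s)) * Real.exp (l * s)) := by ring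
    _ = C / l := by rw [← Real.exp_add]; simp

/-- A globally Lipschitz autonomous ODE on a Banach space has a solution on `[0, ∞)` for every
initial value. -/
theorem LipschitzWith.exists_forall_hasDerivWithinAt_Ici {E : Type*} [NormedAddCommGroup E]
    [NormedSpace ℝ E] [CompleteSpace E] {V : E → E} {K : NNReal} (hV : LipschitzWith K V)
    (x₀ : E) :
    ∃ x : ℝ → E, x 0 = x₀ ∧
      ∀ t ∈ Set.Ici (0 : ℝ), HasDerivWithinAt x (V (x t)) (Set.Ici 0) t := by
  set l : ℝ := K + 1 with hl
  have hl0 : 0 < l := by positivity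
  have hcont (Y : BoundedContinuousFunction ℝ E) :
      Continuous fun r : ℝ => V (Real.exp (l * r) • Y r) :=
    hV.continuous.comp (by fun_prop)
  have hcontI (Y : BoundedContinuousFunction ℝ E) :
      Continuous fun s : ℝ => ∫ r in (0 : ℝ)..s, V (Real.exp (l * r) • Y r) :=
    intervalIntegral.continuous_primitive (fun a b => (hcont Y).intervalIntegrable a b) 0
  have hbound (Y : BoundedContinuousFunction ℝ E) (r : ℝ) (hr : 0 ≤ r) :
      ‖V (Real.exp (l * r) • Y r)‖ ≤ (‖V 0‖ + K * ‖Y‖) * Real.exp (l * r) := by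
    have h1 : 1 ≤ Real.exp (l * r) := Real.one_le_exp (by positivity)
    have h2 := hV.dist_le_mul (Real.exp (l * r) • Y r) 0
    rw [dist_eq_norm, dist_zero_right, norm_smul, Real.norm_of_nonneg (Real.exp_pos _).le] at h2
    have h3 : K * (Real.exp (l * r) * ‖Y r‖) ≤ K * (Real.exp (l * r) * ‖Y‖) := by
      gcongr
      exact Y.norm_coe_le_norm r
    have h4 := norm_sub_norm_le (V (Real.exp (l * r) • Y r)) (V 0)
    nlinarith [norm_nonneg (V 0)]
  let T (Y : BoundedContinuousFunction ℝ E) : BoundedContinuousFunction ℝ E :=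
    BoundedContinuousFunction.ofNormedAddCommGroup
      (fun t => Real.exp (-(l * max t 0)) •
        (x₀ + ∫ r in (0 : ℝ)..max t 0, V (Real.exp (l * r) • Y r)))
      (by
        have := (hcontI Y).comp (continuous_id.max (continuous_const (y := (0 : ℝ))))
        exact Continuous.smul (by fun_prop) (continuous_const.add this))
      (‖x₀‖ + (‖V 0‖ + K * ‖Y‖) / l)
      (fun t => by
        rw [smul_add]
        refine (norm_add_le _ _).trans (add_le_add ?_ ?_)
        · rw [norm_smul, Real.norm_of_nonneg (Real.exp_pos _).le]
          refine mul_le_of_le_one_left (norm_nonneg _) (Real.exp_le_one_iff.2 ?_)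
          have := le_max_right t 0
          nlinarith
        · exact norm_exp_smul_integral_le hl0 (by positivity) (le_max_right _ _) (hbound Y))
  have hT : ContractingWith (K / (K + 1)) T := by
    refine ⟨(div_lt_one (by positivity)).2 (lt_add_one K), LipschitzWith.of_dist_le_mul ?_⟩
    intro Y W
    rw [BoundedContinuousFunction.dist_le (by positivity)]
    intro t
    have hTt : T Y t - T W t = Real.exp (-(l * max t 0)) • ∫ r in (0 : ℝ)..max t 0,
        (V (Real.exp (l * r) • Y r) - V (Real.exp (l * r) • W r)) := by
      rw [intervalIntegral.integral_sub ((hcont Y).intervalIntegrable _ _)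
        ((hcont W).intervalIntegrable _ _)]
      simp only [T, BoundedContinuousFunction.coe_ofNormedAddCommGroup]
      rw [← smul_sub, add_sub_add_left_eq_sub]
    rw [dist_eq_norm, hTt]
    refine (norm_exp_smul_integral_le hl0 (C := K * dist Y W) (by positivity)
      (le_max_right _ _) fun r _ => ?_).trans (le_of_eq ?_)
    · have h2 := hV.dist_le_mul (Real.exp (l * r) • Y r) (Real.exp (l * r) • W r)
      rw [dist_eq_norm, dist_smul₀, Real.norm_of_nonneg (Real.exp_pos _).le] at h2
      refine h2.trans ?_
      rw [mul_assoc, mul_comm (dist Y W)]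
      gcongr
      exact Y.dist_coe_le_dist r
    · push_cast
      rw [hl]
      ring
  set Y := hT.fixedPoint T
  have hY : T Y = Y := hT.fixedPoint_isFixedPt
  have hx (t : ℝ) (ht : 0 ≤ t) : Real.exp (l * t) • Y t =
      x₀ + ∫ r in (0 : ℝ)..t, V (Real.exp (l * r) • Y r) := by
    have : Y t = T Y t := by rw [hY]
    rw [this]
    simp only [T, BoundedContinuousFunction.coe_ofNormedAddCommGroup, max_eq_left ht]
    rw [smul_smul, ← Real.exp_add]
    simp
  refine ⟨fun t => Real.exp (l * t) • Y t, by simpa using hx 0 le_rfl, fun t ht => ?_⟩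
  exact ((((hcont Y).integral_hasStrictDerivAt 0 t).hasDerivAt.const_add
    x₀).hasDerivWithinAt).congr (fun s hs => hx s hs) (hx t ht)

/-- If `f` has a nonnegative derivative within a convex set at each of its points, then `f` is
monotone there. -/
theorem monotoneOn_of_forall_hasDerivWithinAt {D : Set ℝ} (hD : Convex ℝ D) {f f' : ℝ → ℝ}
    (hf : ∀ t ∈ D, HasDerivWithinAt f (f' t) D t) (hf' : ∀ t ∈ D, 0 ≤ f' t) :
    MonotoneOn f D :=
  monotoneOn_of_hasDerivWithinAt_nonneg hD (fun t ht => (hf t ht).continuousWithinAt)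
    (fun t ht => (hf t (interior_subset ht)).mono interior_subset)
    fun t ht => hf' t (interior_subset ht)

section Discrepancy

variable [TopologicalSpace Z] {ρ : Z → Z → ℝ}

theorem IsAntipodal.log_sq_nonpos (h : IsAntipodal ρ) (ξ η : Z) : Real.log (ρ ξ η ^ 2) ≤ 0 :=
  Real.log_nonpos (sq_nonneg _)
    (pow_le_one₀ (h.toIsSeparating.nonneg ξ η) (h.le_one ξ η))

theorem IsAntipodal.le_discrepancy [CompactSpace Z] (h : IsAntipodal ρ) (τ : C(Z, ℝ)) {ξ η : Z}
    (hne : η ≠ ξ) : τ ξ + τ η + Real.log (ρ ξ η ^ 2) ≤ discrepancy ρ τ ξ := by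
  refine le_ciSup (f := fun η : {η : Z // η ≠ ξ} => τ ξ + τ η.1 + Real.log (ρ ξ η.1 ^ 2))
    ⟨‖τ‖ + ‖τ‖, ?_⟩ ⟨η, hne⟩
  rintro _ ⟨ζ, rfl⟩
  have h1 := h.log_sq_nonpos ξ ζ.1
  have h2 := (le_abs_self _).trans (τ.norm_coe_le_norm ξ)
  have h3 := (le_abs_self _).trans (τ.norm_coe_le_norm ζ.1)
  dsimp only
  linarith

theorem IsAntipodalFlowSol.hasDerivWithinAt_apply [CompactSpace Z] {τ : ℝ → C(Z, ℝ)}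
    (hτ : IsAntipodalFlowSol ρ τ) (ξ : Z) {t : ℝ} (ht : 0 ≤ t) :
    HasDerivWithinAt (fun s => τ s ξ) (-discrepancy ρ (τ t) ξ) (Set.Ici 0) t := by
  obtain ⟨τ', hτ', hd⟩ := hτ t ht
  rw [← hτ' ξ]
  exact (ContinuousMap.evalCLM ℝ ξ).hasFDerivAt.comp_hasDerivWithinAt t hd

variable [Nontrivial Z]

theorem discrepancy_le {τ : C(Z, ℝ)} {ξ : Z} {c : ℝ}
    (hc : ∀ η, η ≠ ξ → τ ξ + τ η + Real.log (ρ ξ η ^ 2) ≤ c) : discrepancy ρ τ ξ ≤ c := by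
  obtain ⟨η, hη⟩ := exists_ne ξ
  have : Nonempty {η : Z // η ≠ ξ} := ⟨⟨η, hη⟩⟩
  exact ciSup_le fun η => hc η.1 η.2

variable [CompactSpace Z]

theorem IsAntipodal.discrepancy_eq_add_log_sSup (h : IsAntipodal ρ) (τ : C(Z, ℝ)) (ξ : Z) :
    discrepancy ρ τ ξ =
      τ ξ + Real.log (sSup ((fun η => Real.exp (τ η) * ρ ξ η ^ 2) '' Set.univ)) := by
  have hcont : Continuous fun η => Real.exp (τ η) * ρ ξ η ^ 2 := by
    have : Continuous fun η => ρ ξ η :=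
      h.toIsSeparating.continuous.comp (Continuous.prodMk_right ξ)
    fun_prop
  have hle (η : Z) : Real.exp (τ η) * ρ ξ η ^ 2 ≤
      sSup ((fun η => Real.exp (τ η) * ρ ξ η ^ 2) '' Set.univ) :=
    le_csSup (isCompact_univ.image hcont).bddAbove ⟨η, trivial, rfl⟩
  have hpos {η : Z} (hη : η ≠ ξ) : 0 < ρ ξ η ^ 2 :=
    pow_pos ((h.toIsSeparating.nonneg ξ η).lt_of_ne'
      fun h0 => hη ((h.toIsSeparating.eq_zero_iff ξ η).1 h0).symm) 2
  apply le_antisymm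
  · refine discrepancy_le fun η hη => ?_
    have h1 := Real.log_le_log (mul_pos (Real.exp_pos _) (hpos hη)) (hle η)
    rw [Real.log_mul (Real.exp_pos _).ne' (hpos hη).ne', Real.log_exp] at h1
    linarith
  · obtain ⟨ζ, hζ⟩ := exists_ne ξ
    rw [← le_sub_iff_add_le', Real.log_le_iff_le_exp
      ((mul_pos (Real.exp_pos _) (hpos hζ)).trans_le (hle ζ))]
    refine csSup_le ⟨_, ζ, trivial, rfl⟩ ?_
    rintro _ ⟨η, -, rfl⟩
    rcases eq_or_ne η ξ with rfl | hη
    · have : ρ η η = 0 := (h.toIsSeparating.eq_zero_iff η η).2 rfl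
      simp [this, Real.exp_nonneg]
    · have h1 := h.le_discrepancy τ hη
      dsimp only
      rw [← Real.exp_log (hpos hη), ← Real.exp_add, Real.exp_le_exp]
      linarith

theorem IsAntipodal.continuous_discrepancy (h : IsAntipodal ρ) (τ : C(Z, ℝ)) :
    Continuous (discrepancy ρ τ) := by
  have hρ := h.toIsSeparating.continuous
  have hS : Continuous fun ξ =>
      sSup ((fun η => Real.exp (τ η) * ρ ξ η ^ 2) '' Set.univ) := by
    refine isCompact_univ.continuous_sSup (f := fun ξ η => Real.exp (τ η) * ρ ξ η ^ 2) ?_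
    change Continuous fun p : Z × Z => Real.exp (τ p.2) * ρ p.1 p.2 ^ 2
    fun_prop
  rw [show discrepancy ρ τ = _ from funext (h.discrepancy_eq_add_log_sSup τ)]
  refine τ.continuous.add (hS.log fun ξ => ?_)
  obtain ⟨η, hη⟩ := h.antipode ξ
  have hcont : Continuous fun η => Real.exp (τ η) * ρ ξ η ^ 2 := by
    have : Continuous fun η => ρ ξ η := hρ.comp (Continuous.prodMk_right ξ)
    fun_prop
  have hle : Real.exp (τ η) * ρ ξ η ^ 2 ≤
      sSup ((fun η => Real.exp (τ η) * ρ ξ η ^ 2) '' Set.univ) :=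
    le_csSup (isCompact_univ.image hcont).bddAbove ⟨η, trivial, rfl⟩
  rw [hη] at hle
  exact ((by positivity : (0 : ℝ) < _).trans_le hle).ne'

/-- The vector field `τ ↦ -D_ρ(τ)` of the antipodal flow. -/
noncomputable def IsAntipodal.flowField (h : IsAntipodal ρ) (τ : C(Z, ℝ)) : C(Z, ℝ) where
  toFun ξ := -discrepancy ρ τ ξ
  continuous_toFun := (h.continuous_discrepancy τ).neg

@[simp]
theorem IsAntipodal.flowField_apply (h : IsAntipodal ρ) (τ : C(Z, ℝ)) (ξ : Z) :
    h.flowField τ ξ = -discrepancy ρ τ ξ := rfl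

theorem IsAntipodal.discrepancy_sub_le (h : IsAntipodal ρ) {τ σ : C(Z, ℝ)} {c : ℝ}
    (hc : ∀ η, τ η ≤ σ η + c) (ξ : Z) :
    discrepancy ρ τ ξ - τ ξ ≤ discrepancy ρ σ ξ - σ ξ + c := by
  rw [sub_le_iff_le_add]
  refine discrepancy_le fun η hη => ?_
  have := h.le_discrepancy σ hη
  linarith [hc η]

theorem IsAntipodal.lipschitzWith_flowField_add (h : IsAntipodal ρ) :
    LipschitzWith 1 fun τ => h.flowField τ + τ := by
  refine LipschitzWith.of_dist_le_mul fun τ σ => ?_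
  rw [NNReal.coe_one, one_mul, ContinuousMap.dist_le dist_nonneg]
  intro ξ
  have hc (η : Z) := abs_le.1 ((Real.dist_eq _ _).symm.le.trans
    (ContinuousMap.dist_apply_le_dist (f := τ) (g := σ) η))
  have h1 := h.discrepancy_sub_le (τ := τ) (σ := σ) (c := dist τ σ)
    (fun η => by linarith [(hc η).2]) ξ
  have h2 := h.discrepancy_sub_le (τ := σ) (σ := τ) (c := dist τ σ)
    (fun η => by linarith [(hc η).1]) ξ
  rw [Real.dist_eq, abs_le]
  simp only [ContinuousMap.add_apply, IsAntipodal.flowField_apply]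
  constructor <;> linarith

theorem IsAntipodal.lipschitzWith_flowField (h : IsAntipodal ρ) :
    LipschitzWith 2 h.flowField := by
  have := h.lipschitzWith_flowField_add.sub LipschitzWith.id
  simpa [one_add_one_eq_two, Pi.sub_def] using this

theorem IsAntipodal.discrepancy_zero (h : IsAntipodal ρ) (ξ : Z) :
    discrepancy ρ (0 : C(Z, ℝ)) ξ = 0 := by
  apply le_antisymm
  · exact discrepancy_le fun η _ => by simpa using h.log_sq_nonpos ξ η
  · obtain ⟨η, hη⟩ := h.antipode ξ
    have hne : η ≠ ξ := by
      rintro rfl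
      rw [(h.toIsSeparating.eq_zero_iff η η).2 rfl] at hη
      exact zero_ne_one hη
    simpa [hη] using h.le_discrepancy 0 hne

theorem isAntipodalFlowSol_iff (h : IsAntipodal ρ) {τ : ℝ → C(Z, ℝ)} :
    IsAntipodalFlowSol ρ τ ↔
      ∀ t ∈ Set.Ici (0 : ℝ), HasDerivWithinAt τ (h.flowField (τ t)) (Set.Ici 0) t := by
  refine forall₂_congr fun t _ => ⟨?_, fun ht => ⟨_, fun _ => rfl, ht⟩⟩
  rintro ⟨τ', hτ', ht⟩
  rwa [show h.flowField (τ t) = τ' from ContinuousMap.ext fun ξ => (hτ' ξ).symm]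

theorem IsAntipodalFlowSol.norm_sub_le (h : IsAntipodal ρ) {τ σ : ℝ → C(Z, ℝ)}
    (hτ : IsAntipodalFlowSol ρ τ) (hσ : IsAntipodalFlowSol ρ σ) {t : ℝ} (ht : 0 ≤ t) :
    ‖τ t - σ t‖ ≤ ‖τ 0 - σ 0‖ := by
  let v (s : ℝ) (x : C(Z, ℝ)) : C(Z, ℝ) :=
    Real.exp s • (h.flowField (Real.exp (-s) • x) + Real.exp (-s) • x)
  have hdist (s : ℝ) (x y : C(Z, ℝ)) :
      dist (Real.exp s • x) (Real.exp s • y) = Real.exp s * dist x y := by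
    rw [dist_eq_norm, dist_eq_norm, ← smul_sub, norm_smul,
      Real.norm_of_nonneg (Real.exp_pos _).le]
  have hv (s : ℝ) : LipschitzWith 1 (v s) := by
    refine LipschitzWith.of_dist_le_mul fun x y => ?_
    have := h.lipschitzWith_flowField_add.dist_le_mul (Real.exp (-s) • x) (Real.exp (-s) • y)
    rw [NNReal.coe_one, one_mul, hdist] at this
    rw [NNReal.coe_one, one_mul]
    calc dist (v s x) (v s y) ≤ Real.exp s * (Real.exp (-s) * dist x y) := by
          rw [hdist]
          gcongr
      _ = dist x y := by rw [← mul_assoc, ← Real.exp_add]; simp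
  have hderiv {x : ℝ → C(Z, ℝ)} (hx : IsAntipodalFlowSol ρ x) (s : ℝ) (hs : 0 ≤ s) :
      HasDerivWithinAt (fun s => Real.exp s • x s) (v s (Real.exp s • x s)) (Set.Ici 0) s := by
    have h1 := (Real.hasDerivAt_exp s).hasDerivWithinAt.smul
      ((isAntipodalFlowSol_iff h).1 hx s hs)
    have h2 : v s (Real.exp s • x s) =
        Real.exp s • h.flowField (x s) + Real.exp s • x s := by
      simp only [v, smul_smul, ← Real.exp_add, neg_add_cancel, Real.exp_zero, one_smul, smul_add,
        add_neg_cancel]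
    rw [h2]
    exact h1
  have key := dist_le_of_trajectories_ODE (a := 0) (b := t) hv
    (fun s hs => ((hderiv hτ s hs.1).mono Set.Icc_subset_Ici_self).continuousWithinAt)
    (fun s hs => (hderiv hτ s hs.1).mono (Set.Ici_subset_Ici.2 hs.1))
    (fun s hs => ((hderiv hσ s hs.1).mono Set.Icc_subset_Ici_self).continuousWithinAt)
    (fun s hs => (hderiv hσ s hs.1).mono (Set.Ici_subset_Ici.2 hs.1))
    le_rfl t ⟨ht, le_rfl⟩
  rw [hdist] at key
  simp only [Real.exp_zero, one_smul, NNReal.coe_one, one_mul, sub_zero, dist_eq_norm] at key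
  rw [mul_comm] at key
  exact le_of_mul_le_mul_right key (Real.exp_pos t)

theorem IsAntipodalFlowSol.discrepancy_le_exp (h : IsAntipodal ρ) {τ : ℝ → C(Z, ℝ)}
    (hτ : IsAntipodalFlowSol ρ τ) (ξ : Z) {t : ℝ} (ht : 0 ≤ t) :
    discrepancy ρ (τ t) ξ ≤ 2 * ‖τ 0‖ * Real.exp (-(2 * t)) := by
  refine discrepancy_le fun η hη => ?_
  set c := Real.log (ρ ξ η ^ 2) with hc
  have hmono : MonotoneOn (fun s => -(Real.exp (2 * s) * (τ s ξ + τ s η + c))) (Set.Ici 0) := by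
    refine monotoneOn_of_forall_hasDerivWithinAt (convex_Ici 0)
      (f' := fun s => -(Real.exp (2 * s) * 2 * (τ s ξ + τ s η + c) +
        Real.exp (2 * s) * (-discrepancy ρ (τ s) ξ + -discrepancy ρ (τ s) η)))
      (fun s hs => ?_) (fun s hs => ?_)
    · have h1 : HasDerivWithinAt (fun s : ℝ => Real.exp (2 * s)) (Real.exp (2 * s) * 2)
          (Set.Ici 0) s := by
        simpa using ((hasDerivAt_id s).const_mul 2).exp.hasDerivWithinAt
      exact (h1.mul (((hτ.hasDerivWithinAt_apply ξ hs).add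
        (hτ.hasDerivWithinAt_apply η hs)).add_const c)).neg
    · have h1 := h.le_discrepancy (τ s) hη
      have h2 := h.le_discrepancy (τ s) hη.symm
      rw [h.toIsSeparating.symm η ξ] at h2
      have := Real.exp_pos (2 * s)
      rw [← hc] at h1 h2
      nlinarith
  have h1 := hmono (Set.self_mem_Ici) ht ht
  have h2 := (le_abs_self _).trans ((τ 0).norm_coe_le_norm ξ)
  have h3 := (le_abs_self _).trans ((τ 0).norm_coe_le_norm η)
  have h4 : c ≤ 0 := h.log_sq_nonpos ξ η
  simp only [mul_zero, Real.exp_zero, one_mul] at h1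
  rw [Real.exp_neg, ← div_eq_mul_inv, le_div_iff₀ (Real.exp_pos _), mul_comm]
  linarith

theorem IsAntipodalFlowSol.neg_exp_le_discrepancy (h : IsAntipodal ρ) {τ : ℝ → C(Z, ℝ)}
    (hτ : IsAntipodalFlowSol ρ τ) (ξ : Z) {T : ℝ} (hT : 0 ≤ T) :
    -(4 * ‖τ 0‖ * Real.exp (-T)) ≤ discrepancy ρ (τ T) ξ := by
  set K := ‖τ 0‖ with hK
  have hmono (η : Z) :
      MonotoneOn (fun s => τ s η + -(K * Real.exp (-(2 * s)))) (Set.Ici 0) := by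
    refine monotoneOn_of_forall_hasDerivWithinAt (convex_Ici 0)
      (f' := fun s => -discrepancy ρ (τ s) η + -(K * (Real.exp (-(2 * s)) * -2)))
      (fun s hs => ?_) (fun s hs => ?_)
    · have h1 : HasDerivWithinAt (fun s : ℝ => Real.exp (-(2 * s)))
          (Real.exp (-(2 * s)) * -2) (Set.Ici 0) s := by
        simpa using ((hasDerivAt_id s).const_mul 2).neg.exp.hasDerivWithinAt
      exact (hτ.hasDerivWithinAt_apply η hs).add (h1.const_mul K).neg
    · have := hτ.discrepancy_le_exp h η hs
      linarith
  set v : ℝ → ℝ := fun s => discrepancy ρ (τ s) ξ - τ s ξ with hv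
  have hvle {s : ℝ} (hs : 0 ≤ s) (hsT : s ≤ T) : v s ≤ v T + K * Real.exp (-(2 * s)) := by
    refine h.discrepancy_sub_le (fun η => ?_) ξ
    have h1 := hmono η hs hT hsT
    have : 0 ≤ K * Real.exp (-(2 * T)) := by positivity
    simp only at h1
    linarith
  have hmono' : MonotoneOn (fun s => Real.exp s * (τ s ξ + v T) + -(K * Real.exp (-s)))
      (Set.Icc 0 T) := by
    refine monotoneOn_of_forall_hasDerivWithinAt (convex_Icc 0 T)
      (f' := fun s => Real.exp s * (τ s ξ + v T) + Real.exp s * (-discrepancy ρ (τ s) ξ) +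
        -(K * (Real.exp (-s) * -1)))
      (fun s hs => ?_) (fun s hs => ?_)
    · have h1 : HasDerivWithinAt (fun s : ℝ => Real.exp (-s)) (Real.exp (-s) * -1)
          (Set.Icc 0 T) s := by
        simpa using (hasDerivAt_id s).neg.exp.hasDerivWithinAt
      have h2 := (hτ.hasDerivWithinAt_apply ξ hs.1).mono
        (Set.Icc_subset_Ici_self : Set.Icc 0 T ⊆ _)
      exact ((Real.hasDerivAt_exp s).hasDerivWithinAt.mul (h2.add_const (v T))).add
        (h1.const_mul K).neg
    · have h1 := mul_le_mul_of_nonneg_left (hvle hs.1 hs.2) (Real.exp_pos s).le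
      have h2 : Real.exp s * (K * Real.exp (-(2 * s))) = K * Real.exp (-s) := by
        rw [mul_left_comm, ← Real.exp_add]
        ring_nf
      rw [mul_add, h2] at h1
      simp only [hv] at h1 ⊢
      linarith
  have h1 := hmono' ⟨le_rfl, hT⟩ ⟨hT, le_rfl⟩ hT
  have h0 := hvle le_rfl hT
  have h2 := (abs_le.1 ((τ 0).norm_coe_le_norm ξ)).1
  have h3 := h.discrepancy_sub_le (τ := 0) (σ := τ 0) (c := K)
    (fun η => by
      have := (abs_le.1 ((τ 0).norm_coe_le_norm η)).1
      simp only [ContinuousMap.zero_apply]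
      linarith) ξ
  have h4 : K * Real.exp (-T) ≥ 0 := by positivity
  rw [h.discrepancy_zero] at h3
  simp only [hv, mul_zero, neg_zero, Real.exp_zero, one_mul, mul_one, ContinuousMap.zero_apply,
    add_sub_cancel] at h0 h1 h3
  rw [Real.exp_neg, ← div_eq_mul_inv, ← neg_div, div_le_iff₀ (Real.exp_pos _),
    mul_comm (discrepancy _ _ _)]
  rw [Real.exp_neg, ← div_eq_mul_inv] at h1 h4
  linarith

theorem IsAntipodalFlowSol.exists_tendsto (h : IsAntipodal ρ) {τ : ℝ → C(Z, ℝ)}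
    (hτ : IsAntipodalFlowSol ρ τ) : ∃ σ, Tendsto τ atTop (𝓝 σ) := by
  have hd := (isAntipodalFlowSol_iff h).1 hτ
  have hnorm (t : ℝ) (ht : 0 ≤ t) : ‖h.flowField (τ t)‖ ≤ 4 * ‖τ 0‖ * Real.exp (-t) := by
    rw [ContinuousMap.norm_le _ (by positivity)]
    intro ξ
    rw [h.flowField_apply, norm_neg, Real.norm_eq_abs, abs_le]
    refine ⟨hτ.neg_exp_le_discrepancy h ξ ht, (hτ.discrepancy_le_exp h ξ ht).trans ?_⟩
    gcongr <;> linarith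
  have hint : MeasureTheory.IntegrableOn (fun t => h.flowField (τ t)) (Set.Ioi 0) := by
    refine MeasureTheory.Integrable.mono' ((integrableOn_exp_neg_Ioi 0).const_mul (4 * ‖τ 0‖))
      (ContinuousOn.aestronglyMeasurable (fun t ht => ?_) measurableSet_Ioi) ?_
    · exact h.lipschitzWith_flowField.continuous.continuousAt.comp_continuousWithinAt
        ((hd t (Set.mem_Ici_of_Ioi ht)).continuousWithinAt.mono Set.Ioi_subset_Ici_self)
    · filter_upwards [MeasureTheory.ae_restrict_mem measurableSet_Ioi] with t ht
      exact hnorm t (Set.mem_Ici_of_Ioi ht)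
  exact ⟨_, MeasureTheory.tendsto_limUnder_of_hasDerivAt_of_integrableOn_Ioi
    (fun t ht => (hd t (Set.mem_Ici_of_Ioi ht)).hasDerivAt (Ici_mem_nhds ht)) hint⟩

theorem exists_antipodalization_eq (h : IsAntipodal ρ) (τ₀ : C(Z, ℝ)) :
    ∃ (τ : ℝ → C(Z, ℝ)) (σ : C(Z, ℝ)), τ 0 = τ₀ ∧ IsAntipodalFlowSol ρ τ ∧
      Tendsto τ atTop (𝓝 σ) ∧ antipodalization ρ τ₀ = eMap ρ σ := by
  have hex : ∃ p : (ℝ → C(Z, ℝ)) × C(Z, ℝ), p.1 0 = τ₀ ∧ IsAntipodalFlowSol ρ p.1 ∧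
      Tendsto p.1 atTop (𝓝 p.2) := by
    obtain ⟨τ, h0, hτ⟩ := h.lipschitzWith_flowField.exists_forall_hasDerivWithinAt_Ici τ₀
    have hτ' := (isAntipodalFlowSol_iff h).2 hτ
    obtain ⟨σ, hσ⟩ := hτ'.exists_tendsto h
    exact ⟨(τ, σ), h0, hτ', hσ⟩
  obtain ⟨h0, hsol, hlim⟩ := hex.choose_spec
  exact ⟨hex.choose.1, hex.choose.2, h0, hsol, hlim, dif_pos hex⟩

end Discrepancy

theorem HasFourPoints.exists_ne_ne (h4 : HasFourPoints Z) (ξ : Z) :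
    ∃ η ζ : Z, η ≠ ξ ∧ ζ ≠ ξ ∧ η ≠ ζ := by
  obtain ⟨a, b, c, d, hab, hac, -, hbc, -⟩ := h4
  by_cases ha : a = ξ
  · subst ha
    exact ⟨b, c, hab.symm, hac.symm, hbc⟩
  · by_cases hb : b = ξ
    · subst hb
      exact ⟨a, c, hab, hbc.symm, hac⟩
    · exact ⟨a, b, ha, hb, hab⟩

theorem mDeriv_eq [TopologicalSpace Z] (h4 : HasFourPoints Z) {ρ₁ ρ₂ : Z → Z → ℝ}
    (hρ₁ : ∀ ξ η, ρ₁ ξ η = 0 → ξ = η) {f : Z → ℝ} (hf : Continuous f) (hpos : ∀ ξ, 0 < f ξ)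
    (heq : ∀ ξ η, ρ₂ ξ η ^ 2 = f ξ * f η * ρ₁ ξ η ^ 2) : mDeriv ρ₁ ρ₂ = f := by
  have hex : ∃ f : Z → ℝ, Continuous f ∧ (∀ ξ, 0 < f ξ) ∧
      ∀ ξ η, ρ₂ ξ η ^ 2 = f ξ * f η * ρ₁ ξ η ^ 2 := ⟨f, hf, hpos, heq⟩
  rw [mDeriv, dif_pos hex]
  obtain ⟨-, hgpos, hgeq⟩ := hex.choose_spec
  set g := hex.choose
  have hmul {ξ η : Z} (hne : ξ ≠ η) : g ξ * g η = f ξ * f η :=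
    mul_right_cancel₀ (pow_ne_zero 2 fun h0 => hne (hρ₁ ξ η h0))
      ((hgeq ξ η).symm.trans (heq ξ η))
  funext ξ
  obtain ⟨η, ζ, hη, hζ, hηζ⟩ := h4.exists_ne_ne ξ
  have hsq : g ξ ^ 2 = f ξ ^ 2 := by
    refine mul_right_cancel₀ (mul_pos (hgpos η) (hgpos ζ)).ne' ?_
    calc g ξ ^ 2 * (g η * g ζ) = (g ξ * g η) * (g ξ * g ζ) := by ring
      _ = f ξ ^ 2 * (f η * f ζ) := by rw [hmul hη.symm, hmul hζ.symm]; ring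
      _ = f ξ ^ 2 * (g η * g ζ) := by rw [hmul hηζ]
  exact (pow_left_inj₀ (hgpos ξ).le (hpos ξ).le two_ne_zero).1 hsq

theorem dM_eMap_le [TopologicalSpace Z] [CompactSpace Z] (h4 : HasFourPoints Z)
    {ρ : Z → Z → ℝ} (hρ : ∀ ξ η, ρ ξ η = 0 → ξ = η) (τ σ : C(Z, ℝ)) :
    dM (eMap ρ τ) (eMap ρ σ) ≤ ‖σ - τ‖ := by
  have hne : Nonempty Z := ⟨h4.choose⟩
  have hD : mDeriv (eMap ρ τ) (eMap ρ σ) = fun ξ => Real.exp ((σ - τ) ξ) := by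
    refine mDeriv_eq h4 (fun ξ η h0 => hρ ξ η ?_) (by fun_prop) (fun ξ => Real.exp_pos _)
      fun ξ η => ?_
    · simpa [eMap, Real.exp_ne_zero] using h0
    · simp only [eMap, mul_pow, ← Real.exp_nat_mul, ← mul_assoc, ← Real.exp_add,
        ContinuousMap.sub_apply]
      ring_nf
  rw [dM, hD]
  refine ciSup_le fun ξ => ?_
  rw [Real.log_exp]
  exact (σ - τ).norm_coe_le_norm ξ

theorem statement9 [TopologicalSpace Z] [CompactSpace Z]
    [TopologicalSpace.MetrizableSpace Z] (h4 : HasFourPoints Z)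
    (ρ₀ : Z → Z → ℝ) (h₀ : IsAntipodal ρ₀)
    (ρ₁ : Z → Z → ℝ) (hρ₁ : ρ₁ ∈ MoebiusSpace ρ₀) :
    ∀ τ₀ : C(Z, ℝ), ∀ ε > (0 : ℝ), ∃ δ > (0 : ℝ), ∀ τ : C(Z, ℝ), ‖τ - τ₀‖ < δ →
      dM (antipodalization ρ₁ τ₀) (antipodalization ρ₁ τ) < ε := by
  obtain ⟨a, b, -, -, hab, -⟩ := id h4
  have : Nontrivial Z := ⟨a, b, hab⟩
  have h := hρ₁.1
  intro τ₀ ε hε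
  refine ⟨ε, hε, fun τ hτ => ?_⟩
  obtain ⟨x, x', hx0, hx, hxlim, hx'⟩ := exists_antipodalization_eq h τ₀
  obtain ⟨y, y', hy0, hy, hylim, hy'⟩ := exists_antipodalization_eq h τ
  rw [hx', hy']
  refine (dM_eMap_le h4 (fun ξ η => (h.toIsSeparating.eq_zero_iff ξ η).1) x' y').trans_lt
    (lt_of_le_of_lt ?_ hτ)
  refine le_of_tendsto (hylim.sub hxlim).norm ?_
  filter_upwards [eventually_ge_atTop 0] with t ht
  simpa only [hx0, hy0] using hy.norm_sub_le h hx ht
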